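/- For every k ≥ 4, the inducibility of the sparkler S'_k with k edges is at least 13/165; that is, there exists a sequence (T_n) of trees with |T_n| → ∞ such that d(S'_k, T_n) ≥ 13/165 for all n. -/

import Mathlib

open SimpleGraph Filter

/-- The degree of a vertex, as the cardinality of its neighbour set. -/
noncomputable def ndeg {V : Type*} (G : SimpleGraph V) (v : V) : ℕ :=
  (G.neighborSet v).ncard

/-- `Z_k(G)`: the number of `k`-vertex subtrees (connected subgraphs) of `G`. -/
noncomputable def subtreeCount {V : Type*} [Fintype V] (G : SimpleGraph V) (k : ℕ) : ℕ :=
  {s : Finset V | s.card = k ∧ (G.induce (s : Set V)).Connected}.ncard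

/-- The number of embeddings (subtrees isomorphic to `S`) of a tree `S` in `G`,
counted among `k`-vertex subtrees. -/
noncomputable def embCount {V W : Type*} [Fintype V] (G : SimpleGraph V)
    (S : SimpleGraph W) (k : ℕ) : ℕ :=
  {s : Finset V | s.card = k ∧ Nonempty ((G.induce (s : Set V)) ≃g S)}.ncard

/-- The density `d(S,T)`: the number of embeddings of the `|S|`-vertex tree `S` in `T`
divided by the number of `|S|`-vertex subtrees of `T` (`0` if `T` has fewer vertices). -/
noncomputable def density {V W : Type*} [Fintype V] [Fintype W]
    (S : SimpleGraph W) (T : SimpleGraph V) : ℝ :=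
  (embCount T S (Fintype.card W) : ℝ) / (subtreeCount T (Fintype.card W) : ℝ)

/-- `max { d(S,T) : T an n-vertex tree }`. -/
noncomputable def maxDensity {W : Type*} [Fintype W] (S : SimpleGraph W) (n : ℕ) : ℝ :=
  sSup {x : ℝ | ∃ T : SimpleGraph (Fin n), T.IsTree ∧ x = density S T}

/-- The inducibility of `S`: `limsup_{n → ∞} max { d(S,T) : T an n-vertex tree }`. -/
noncomputable def inducibility {W : Type*} [Fintype W] (S : SimpleGraph W) : ℝ :=
  Filter.limsup (maxDensity S) Filter.atTop

/-- A graph is starlike if it has at most one non-leaf vertex. -/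
def IsStarlike {V : Type*} (G : SimpleGraph V) : Prop :=
  {v | ndeg G v ≠ 1}.Subsingleton

/-- A graph is pathlike if its maximum degree is at most 2. -/
def IsPathlike {V : Type*} (G : SimpleGraph V) : Prop :=
  ∀ v, ndeg G v ≤ 2

/-- The vertex set of the component of `u` in `G - v`; together with the edge `uv`, this is
the branch of `G` rooted at `v` through its neighbour `u`. -/
def branchSet {V : Type*} (G : SimpleGraph V) (v u : V) : Set V :=
  {w | ∃ p : G.Walk u w, v ∉ p.support}

/-- The branch of `G` rooted at `v` through `u` is non-trivial if it is not a single edge. -/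
def NontrivialBranch {V : Type*} (G : SimpleGraph V) (v u : V) : Prop :=
  G.Adj v u ∧ branchSet G v u ≠ {u}

/-- The branch rooted at `v` through `u` is a fork: non-trivial and isomorphic to a star in
which `v` is a leaf (all vertices of the branch other than `u` and `v` are leaves of `G`). -/
def IsFork {V : Type*} (G : SimpleGraph V) (v u : V) : Prop :=
  NontrivialBranch G v u ∧ ∀ w ∈ branchSet G v u, w ≠ u → ndeg G w = 1

/-- The order of a fork: its number of leaves other than the root. -/
noncomputable def forkOrder {V : Type*} (G : SimpleGraph V) (v u : V) : ℕ :=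
  (branchSet G v u).ncard - 1

/-- A branch is major if it is non-trivial and not a fork. -/
def IsMajor {V : Type*} (G : SimpleGraph V) (v u : V) : Prop :=
  NontrivialBranch G v u ∧ ¬ IsFork G v u

/-- A caterpillar is a tree in which every vertex is the root of at most two
non-trivial branches. -/
def IsCaterpillar {V : Type*} (G : SimpleGraph V) : Prop :=
  G.IsTree ∧ ∀ v, {u | NontrivialBranch G v u}.ncard ≤ 2

/-- A center of `G`: each branch rooted at `v` has at most `|G|/2` edges (the branch through
a neighbour `u` has `(branchSet G v u).ncard` edges). -/
def IsCenter {V : Type*} [Fintype V] (G : SimpleGraph V) (v : V) : Prop :=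
  ∀ u, G.Adj v u → 2 * (branchSet G v u).ncard ≤ Fintype.card V

/-- `v` is the root of at least three non-trivial branches. -/
def RootsThreeNontrivial {V : Type*} (G : SimpleGraph V) (v : V) : Prop :=
  3 ≤ {u | NontrivialBranch G v u}.ncard

/-- A hub of `G`: a vertex `v` that is the only vertex on the path from `v` to the nearest
center of `G` that is the root of at least three non-trivial branches.  (A vertex `w` lies on
the path from `v` to `c` iff `dist v w + dist w c = dist v c`.) -/
def IsHub {V : Type*} [Fintype V] (G : SimpleGraph V) (v : V) : Prop :=
  RootsThreeNontrivial G v ∧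
  ∃ c, IsCenter G c ∧ (∀ c', IsCenter G c' → G.dist v c ≤ G.dist v c') ∧
    ∀ w, G.dist v w + G.dist w c = G.dist v c → w ≠ v → ¬ RootsThreeNontrivial G w

/-- The sparkler with k edges: the star with k-1 leaves with one edge subdivided.
Vertex 0 is the center (adjacent to 1 and to 3, ..., k), vertex 1 is the subdivision
vertex (adjacent to 0 and 2). -/
def sparkler (k : ℕ) : SimpleGraph (Fin (k + 1)) :=
  SimpleGraph.fromRel (fun a b =>
    ((a : ℕ) = 0 ∧ (b : ℕ) ≠ 0 ∧ (b : ℕ) ≠ 2) ∨ ((a : ℕ) = 1 ∧ (b : ℕ) = 2))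

lemma embCount_le_of_iso {V V' W : Type*} [Fintype V] [Fintype V'] {G : SimpleGraph V}
    {H : SimpleGraph V'} (φ : G ≃g H) (S : SimpleGraph W) (j : ℕ) :
    embCount G S j ≤ embCount H S j := by
  refine Set.ncard_le_ncard_of_injOn (Finset.map φ.toEquiv.toEmbedding) ?_
    (Finset.map_injective _).injOn (Set.toFinite _)
  rintro s ⟨hs, ⟨ψ⟩⟩
  refine ⟨by simpa using hs, ⟨RelIso.trans ?_ ψ⟩⟩
  exact (φ.induce (by
    rw [Finset.coe_map]
    exact φ.injective.injOn.bijOn_image)).symm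

lemma subtreeCount_le_of_iso {V V' : Type*} [Fintype V] [Fintype V'] {G : SimpleGraph V}
    {H : SimpleGraph V'} (φ : G ≃g H) (j : ℕ) : subtreeCount G j ≤ subtreeCount H j := by
  refine Set.ncard_le_ncard_of_injOn (Finset.map φ.toEquiv.toEmbedding) ?_
    (Finset.map_injective _).injOn (Set.toFinite _)
  rintro s ⟨hs, hconn⟩
  refine ⟨by simpa using hs, (SimpleGraph.Iso.connected_iff (φ.induce ?_)).1 hconn⟩
  rw [Finset.coe_map]
  exact φ.injective.injOn.bijOn_image

lemma embCount_le_subtreeCount {V W : Type*} [Fintype V] {G : SimpleGraph V} {S : SimpleGraph W}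
    (hS : S.Connected) (j : ℕ) : embCount G S j ≤ subtreeCount G j :=
  Set.ncard_le_ncard (fun _ hs => ⟨hs.1, (SimpleGraph.Iso.connected_iff hs.2.some).2 hS⟩)
    (Set.toFinite _)

/-- The graph in which every vertex is joined to its image under `p`. -/
def parentGraph {V : Type*} (p : V → V) : SimpleGraph V :=
  SimpleGraph.fromRel fun u v => p u = v

lemma parentGraph_isTree {V : Type*} [Finite V] {p : V → V} {h : V → ℕ} {r : V}
    (hr : p r = r) (hp : ∀ v, v ≠ r → h (p v) < h v) : (parentGraph p).IsTree := by
  have hreach : ∀ n v, h v = n → (parentGraph p).Reachable v r := by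
    intro n
    induction n using Nat.strong_induction_on with
    | _ n ih =>
      rintro v rfl
      by_cases hv : v = r
      · rw [hv]
      · have hlt := hp v hv
        refine SimpleGraph.Reachable.trans (SimpleGraph.Adj.reachable ?_) (ih _ hlt _ rfl)
        refine (SimpleGraph.fromRel_adj _ _ _).2 ⟨fun he => ?_, Or.inl rfl⟩
        rw [← he] at hlt
        exact lt_irrefl _ hlt
  have hconn : (parentGraph p).Connected :=
    { preconnected := fun u v => (hreach _ u rfl).trans (hreach _ v rfl).symm
      nonempty := ⟨r⟩ }
  refine SimpleGraph.isTree_iff_connected_and_card.2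
    ⟨hconn, le_antisymm ?_ hconn.card_vert_le_card_edgeSet_add_one⟩
  have hsub : (parentGraph p).edgeSet ⊆ (fun v => s(v, p v)) '' {v | v ≠ r} := by
    intro e
    induction e with
    | _ u v =>
      intro he
      rw [SimpleGraph.mem_edgeSet, parentGraph, SimpleGraph.fromRel_adj] at he
      obtain ⟨hne, rfl | rfl⟩ := he
      · exact ⟨u, fun hu => hne (by rw [hu, hr]), rfl⟩
      · exact ⟨v, fun hv => hne (by rw [hv, hr]), Sym2.eq_swap⟩
  have hcard := (Set.ncard_le_ncard hsub (Set.toFinite _)).trans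
    (Set.ncard_image_le (Set.toFinite _))
  have hcompl : ({r} : Set V).ncard + ({r}ᶜ : Set V).ncard = Nat.card V :=
    Set.ncard_add_ncard_compl _
  rw [Set.ncard_singleton] at hcompl
  rw [Nat.card_coe_set_eq]
  have : {v | v ≠ r} = ({r}ᶜ : Set V) := rfl
  rw [this] at hcard
  omega

/-- A connected set of vertices of a parent graph is closed under taking parents, except at its
lowest vertex. -/
lemma exists_root_of_connected {V : Type*} {p : V → V} {h : V → ℕ}
    (hp : ∀ v, p v = v ∨ h (p v) < h v) {s : Finset V}
    (hs : ((parentGraph p).induce (s : Set V)).Connected) :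
    ∃ r ∈ s, (∀ v ∈ s, h r ≤ h v) ∧ ∀ v ∈ s, v ≠ r → p v ∈ s := by
  obtain ⟨⟨r₀, hr₀⟩⟩ := hs.nonempty
  obtain ⟨r, hr, hmin⟩ := s.exists_min_image h ⟨r₀, hr₀⟩
  refine ⟨r, hr, hmin, fun v hv hvr => ?_⟩
  have hiter : ∀ i, p^[i] r = r ∨ h (p^[i] r) < h r := by
    intro i
    induction i with
    | zero => exact Or.inl rfl
    | succ i ih =>
      rw [Function.iterate_succ_apply']
      rcases hp (p^[i] r) with h1 | h1 <;> rcases ih with h2 | h2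
      · exact Or.inl (h1.trans h2)
      · exact Or.inr (by rwa [h1])
      · exact Or.inr (by rwa [h2] at h1 ⊢)
      · exact Or.inr (h1.trans h2)
  obtain ⟨w⟩ := hs.preconnected ⟨v, hv⟩ ⟨r, hr⟩
  obtain ⟨d, -, ⟨i, hi⟩, hd⟩ := w.exists_boundary_dart {x | ∃ i, p^[i] (x : V) = v} ⟨0, rfl⟩ (by
    rintro ⟨i, hi⟩
    rcases hiter i with h1 | h1
    · exact hvr (hi.symm.trans h1)
    · exact absurd (hmin v hv) (by rw [← hi]; exact not_le.2 h1))
  have hadj : (parentGraph p).Adj (d.fst : V) d.snd := d.adj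
  obtain ⟨-, h1 | h1⟩ := hadj
  · cases i with
    | zero =>
      have h2 : (d.fst : V) = v := hi
      rw [← h2, h1]
      exact d.snd.2
    | succ i =>
      refine absurd ⟨i, ?_⟩ hd
      rwa [Function.iterate_succ_apply, h1] at hi
  · exact absurd ⟨i + 1, by rw [Function.iterate_succ_apply, h1]; exact hi⟩ hd

lemma eq_Ico_of_pred_mem {A : Finset ℕ} {m : ℕ} (hmin : ∀ x ∈ A, m ≤ x)
    (hpred : ∀ x ∈ A, x ≠ m → x - 1 ∈ A) : A = Finset.Ico m (m + A.card) := by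
  have hdown : ∀ t x, x + t ∈ A → m ≤ x → x ∈ A := by
    intro t
    induction t with
    | zero => exact fun x hx _ => hx
    | succ t ih => exact fun x hx hmx => ih x (hpred _ hx (by omega)) hmx
  refine Finset.eq_of_subset_of_card_le (fun x hx => ?_) (by simp)
  have hsub : Finset.Icc m x ⊆ A := by
    intro y hy
    rw [Finset.mem_Icc] at hy
    exact hdown (x - y) y (by rwa [Nat.add_sub_cancel' hy.2]) hy.1
  have hc := Finset.card_le_card hsub
  rw [Nat.card_Icc] at hc
  have := hmin x hx
  rw [Finset.mem_Ico]
  omega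

lemma sparkler_adj {k : ℕ} {a b : Fin (k + 1)} : (sparkler k).Adj a b ↔ (a : ℕ) ≠ b ∧
    ((((a : ℕ) = 0 ∧ (b : ℕ) ≠ 0 ∧ (b : ℕ) ≠ 2) ∨ ((a : ℕ) = 1 ∧ (b : ℕ) = 2)) ∨
      (((b : ℕ) = 0 ∧ (a : ℕ) ≠ 0 ∧ (a : ℕ) ≠ 2) ∨ ((b : ℕ) = 1 ∧ (a : ℕ) = 2))) := by
  rw [sparkler, SimpleGraph.fromRel_adj, ne_eq, Fin.ext_iff]

lemma sparkler_connected (K : ℕ) : (sparkler (K + 2)).Connected := by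
  have h0 : ∀ v : Fin (K + 2 + 1), (sparkler (K + 2)).Reachable 0 v := by
    have hadj : ∀ v : Fin (K + 2 + 1), (v : ℕ) ≠ 0 → (v : ℕ) ≠ 2 →
        (sparkler (K + 2)).Adj 0 v := by
      intro v h1 h2
      rw [sparkler_adj]
      exact ⟨fun h => h1 h.symm, Or.inl (Or.inl ⟨rfl, h1, h2⟩)⟩
    intro v
    by_cases hv0 : (v : ℕ) = 0
    · rw [show v = 0 from Fin.ext hv0]
    by_cases hv2 : (v : ℕ) = 2
    · refine (hadj ⟨1, by omega⟩ (by simp) (by simp)).reachable.trans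
        (SimpleGraph.Adj.reachable ?_)
      rw [sparkler_adj]
      exact ⟨fun h => by simp [hv2] at h, Or.inl (Or.inr ⟨rfl, hv2⟩)⟩
    · exact (hadj v hv0 hv2).reachable
  exact { preconnected := fun u v => (h0 u).symm.trans (h0 v), nonempty := ⟨0⟩ }

lemma sparkler_induce_iso {V : Type*} [DecidableEq V] {G : SimpleGraph V} {K : ℕ} {c x y : V}
    {A : Finset V} (hA : A.card = K) (hcx : G.Adj c x) (hxy : G.Adj x y) (hcy : ¬ G.Adj c y)
    (hne : c ≠ y) (hxA : x ∉ A) (hcA : ∀ a ∈ A, G.Adj c a) (hxA' : ∀ a ∈ A, ¬ G.Adj x a)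
    (hyA : ∀ a ∈ A, ¬ G.Adj y a) (hAA : ∀ a ∈ A, ∀ b ∈ A, ¬ G.Adj a b) :
    (insert c (insert x (insert y A))).card = K + 3 ∧
      Nonempty (G.induce ((insert c (insert x (insert y A)) : Finset V) : Set V) ≃g
        sparkler (K + 2)) := by
  have hyA' : y ∉ A := fun h => hxA' y h hxy
  have hcA' : c ∉ A := fun h => (hcA c h).ne rfl
  refine ⟨by simp [*, hcx.ne, hxy.ne], ?_⟩
  let e : Fin K ≃ A := (finCongr hA.symm).trans A.equivFin.symm
  let f : Fin (K + 3) → V :=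
    Fin.cons c (Fin.cons x (Fin.cons y fun j => (e j : V)))
  have hmem : ∀ j, (e j : V) ∈ A := fun j => (e j).2
  have hf : Function.Injective f := by
    simp only [f, Fin.cons_injective_iff]
    refine ⟨?_, ?_, ?_, Subtype.val_injective.comp e.injective⟩
    · rintro ⟨j, hj⟩
      revert hj
      refine Fin.cases ?_ (Fin.cases ?_ ?_) j
      · exact fun hj => hcx.ne hj.symm
      · exact fun hj => hne hj.symm
      · exact fun i hj => hcA' (hj ▸ hmem i)
    · rintro ⟨j, hj⟩
      revert hj
      refine Fin.cases ?_ ?_ j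
      · exact fun hj => hxy.ne hj.symm
      · exact fun i hj => hxA (hj ▸ hmem i)
    · rintro ⟨i, hj⟩
      exact hyA' (hj ▸ hmem i)
  have hrange : Set.range f = ((insert c (insert x (insert y A)) : Finset V) : Set V) := by
    simp only [f, Fin.range_cons, Finset.coe_insert]
    congr 3
    ext v
    exact ⟨fun ⟨j, hj⟩ => hj ▸ hmem j, fun hv => ⟨e.symm ⟨v, hv⟩, by simp⟩⟩
  have hyc : ¬ G.Adj y c := fun h => hcy h.symm
  have hce : ∀ j, G.Adj c (e j) := fun j => hcA _ (hmem j)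
  have hxe : ∀ j, ¬ G.Adj x (e j) := fun j => hxA' _ (hmem j)
  have hye : ∀ j, ¬ G.Adj y (e j) := fun j => hyA _ (hmem j)
  have hex : ∀ j, ¬ G.Adj (e j) x := fun j h => hxe j h.symm
  have hey : ∀ j, ¬ G.Adj (e j) y := fun j h => hye j h.symm
  have hee : ∀ i j, ¬ G.Adj (e i) (e j) := fun i j => hAA _ (hmem i) _ (hmem j)
  let g : sparkler (K + 2) ↪g G :=
    { toFun := f
      inj' := hf
      map_rel_iff' := by
        intro a b
        change G.Adj (f a) (f b) ↔ _
        have h0 : f 0 = c := rfl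
        have h1 : f (Fin.succ 0) = x := rfl
        have h2 : f (Fin.succ (Fin.succ 0)) = y := rfl
        have h3 : ∀ j : Fin K, f j.succ.succ.succ = e j := fun j => rfl
        rw [sparkler_adj]
        refine Fin.cases ?_ (Fin.cases ?_ (Fin.cases ?_ fun i => ?_)) a <;>
        refine Fin.cases ?_ (Fin.cases ?_ (Fin.cases ?_ fun j => ?_)) b <;>
        simp only [h0, h1, h2, h3, Fin.val_succ, Fin.val_zero] <;>
        simp [hcx, hxy, hcy, hcx.symm, hxy.symm, hyc, hce, (hce _).symm, hxe, hye, hex, hey, hee] }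
  rw [← hrange]
  exact ⟨g.isoInduceRange.symm⟩

/-- The vertices of a caterpillar: a spine of `N * (K + 3)` vertices and `N` bunches of `a`
leaves. -/
abbrev CaterpillarVertex (K N a : ℕ) : Type :=
  Fin (N * (K + 3)) ⊕ (Fin N × Fin a)

lemma block_lt {K N q : ℕ} (i : Fin N) (hq : q < K + 3) :
    (i : ℕ) * (K + 3) + q < N * (K + 3) := by
  have h1 : ((i : ℕ) + 1) * (K + 3) ≤ N * (K + 3) := Nat.mul_le_mul_right _ i.2
  rw [add_mul, one_mul] at h1
  omega

/-- The `q`-th spine vertex of the `i`-th block. -/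
def spineVertex {K N : ℕ} (i : Fin N) (q : ℕ) (hq : q < K + 3) : Fin (N * (K + 3)) :=
  ⟨i * (K + 3) + q, block_lt i hq⟩

/-- The parent function of the caterpillar: spine vertices point to their predecessor on the
spine, leaves point to the third spine vertex of their block. -/
def caterpillarParent {K N a : ℕ} : CaterpillarVertex K N a → CaterpillarVertex K N a
  | .inl x => .inl ⟨x - 1, (Nat.sub_le _ _).trans_lt x.2⟩
  | .inr l => .inl (spineVertex l.1 2 (by omega))

/-- The caterpillar with `N` blocks, each having `K + 3` spine vertices and `a` leaves attached
to the third of them. -/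
def caterpillar (K N a : ℕ) : SimpleGraph (CaterpillarVertex K N a) :=
  parentGraph caterpillarParent

/-- The position along the spine, leaves coming after all spine vertices. -/
def caterpillarHeight {K N a : ℕ} : CaterpillarVertex K N a → ℕ
  | .inl x => x
  | .inr _ => N * (K + 3)

lemma caterpillar_isTree {K N a : ℕ} (hN : 0 < N) : (caterpillar K N a).IsTree := by
  refine parentGraph_isTree (h := caterpillarHeight) (r := .inl ⟨0, by positivity⟩) rfl ?_
  rintro (x | l) hv
  · have : (x : ℕ) ≠ 0 := fun h => hv (congrArg Sum.inl (Fin.ext h))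
    simp only [caterpillarParent, caterpillarHeight]
    omega
  · exact Fin.is_lt _

lemma caterpillar_adj_inl_inl {K N a : ℕ} {x y : Fin (N * (K + 3))} :
    (caterpillar K N a).Adj (.inl x) (.inl y) ↔ (x : ℕ) + 1 = y ∨ (y : ℕ) + 1 = x := by
  simp only [caterpillar, parentGraph, SimpleGraph.fromRel_adj, caterpillarParent, ne_eq,
    Sum.inl.injEq, Fin.ext_iff]
  omega

lemma caterpillar_adj_inl_inr {K N a : ℕ} {x : Fin (N * (K + 3))} {l : Fin N × Fin a} :
    (caterpillar K N a).Adj (.inl x) (.inr l) ↔ (x : ℕ) = l.1 * (K + 3) + 2 := by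
  simp [caterpillar, parentGraph, SimpleGraph.fromRel_adj, caterpillarParent, spineVertex,
    Fin.ext_iff, eq_comm]

lemma not_caterpillar_adj_inr_inr {K N a : ℕ} {l l' : Fin N × Fin a} :
    ¬ (caterpillar K N a).Adj (.inr l) (.inr l') := by
  simp [caterpillar, parentGraph, SimpleGraph.fromRel_adj, caterpillarParent]

/-- The vertex set formed by the leaves `L` of block `i` and the spine interval containing the
third spine vertex of that block and `t` vertices before it, `K + 3` vertices in total. -/
def caterpillarSubtree {K N a : ℕ} (z : Fin N × Σ L : Finset (Fin a), Fin (K + 3 - L.card)) :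
    Finset (CaterpillarVertex K N a) :=
  ({x : Fin (N * (K + 3)) | (z.1 : ℕ) * (K + 3) + 2 ≤ x + z.2.2 ∧
    (x : ℕ) + z.2.2 < z.1 * (K + 3) + 2 + (K + 3 - z.2.1.card)} : Finset _).disjSum
    (z.2.1.map ⟨fun l => (z.1, l), fun _ _ h => (Prod.ext_iff.1 h).2⟩)

lemma exists_caterpillarSubtree_eq {K N a : ℕ} {s : Finset (CaterpillarVertex K N a)}
    (hcard : s.card = K + 3) (hs : ((caterpillar K N a).induce (s : Set _)).Connected) :
    ∃ z, caterpillarSubtree z = s := by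
  have hp : ∀ v : CaterpillarVertex K N a, caterpillarParent v = v ∨
      caterpillarHeight (caterpillarParent v) < caterpillarHeight v := by
    rintro (x | l)
    · by_cases h : (x : ℕ) = 0
      · exact Or.inl (congrArg Sum.inl (Fin.ext (by simp [h])))
      · right
        simp only [caterpillarParent, caterpillarHeight]
        omega
    · exact Or.inr (Fin.is_lt _)
  obtain ⟨r, hr, hmin, hclosed⟩ := exists_root_of_connected hp hs
  obtain ⟨m, rfl⟩ : ∃ m, r = .inl m := by
    rcases r with m | l
    · exact ⟨m, rfl⟩
    · obtain ⟨v, hv, hne⟩ := s.exists_mem_ne (by omega) (.inr l)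
      rcases v with x | l'
      · exact absurd (hmin _ hv) (not_le.2 x.2)
      · exact absurd (hmin _ (hclosed _ hv hne)) (not_le.2 (Fin.is_lt _))
  set A : Finset ℕ := s.toLeft.map Fin.valEmbedding with hA
  have hmemA : ∀ x : Fin (N * (K + 3)), (x : ℕ) ∈ A ↔ .inl x ∈ s := by
    intro x
    simp [hA, Fin.val_inj]
  have hAcard : A.card + s.toRight.card = K + 3 := by
    rw [hA, Finset.card_map, Finset.card_toLeft_add_card_toRight, hcard]
  have hIco : A = Finset.Ico (m : ℕ) (m + A.card) := by
    refine eq_Ico_of_pred_mem (fun x hx => ?_) (fun x hx hxm => ?_)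
    all_goals
      obtain ⟨x, hx', rfl⟩ := Finset.mem_map.1 hx
      rw [Finset.mem_toLeft] at hx'
    · exact hmin _ hx'
    · exact (hmemA _).2 (hclosed _ hx' fun h => hxm (congrArg _ (Sum.inl.inj h)))
  have hcenter : ∀ l ∈ s.toRight, (l.1 : ℕ) * (K + 3) + 2 ∈ A := by
    intro l hl
    exact (hmemA (spineVertex l.1 2 (by omega))).2
      (hclosed _ (Finset.mem_toRight.1 hl) Sum.inr_ne_inl)
  have hmA : (m : ℕ) ∈ A := (hmemA m).2 hr
  have hApos : 0 < A.card := Finset.card_pos.2 ⟨_, hmA⟩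
  have hlast : (m : ℕ) + A.card ≤ N * (K + 3) := by
    have : (m : ℕ) + A.card - 1 ∈ A := by
      rw [hIco, Finset.mem_Ico]
      simp only [Nat.card_Ico]
      omega
    obtain ⟨x, -, hx⟩ := Finset.mem_map.1 this
    have h1 := x.2
    have h2 : (x : ℕ) = m + A.card - 1 := hx
    omega
  obtain ⟨i, hi, hright⟩ : ∃ i : Fin N, (i : ℕ) * (K + 3) + 2 ∈ A ∧ ∀ l ∈ s.toRight, l.1 = i := by
    rcases s.toRight.eq_empty_or_nonempty with he | ⟨l, hl⟩
    · rw [he, Finset.card_empty, add_zero] at hAcard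
      have hdiv := Nat.div_mul_le_self (m + K) (K + 3)
      refine ⟨⟨(m + K) / (K + 3), ?_⟩, ?_, by simp [he]⟩
      · rw [Nat.div_lt_iff_lt_mul (by omega)]
        omega
      · rw [hIco, Finset.mem_Ico, hAcard]
        have := Nat.lt_div_mul_add (a := m + K) (b := K + 3) (by omega)
        simp only
        omega
    · refine ⟨l.1, hcenter l hl, fun l' hl' => ?_⟩
      have h1 := hcenter l hl
      have h2 := hcenter l' hl'
      have hpos : 0 < s.toRight.card := Finset.card_pos.2 ⟨_, hl⟩
      rw [hIco, Finset.mem_Ico] at h1 h2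
      by_contra hne
      rcases lt_or_gt_of_ne (fun h => hne (Fin.ext h) : (l'.1 : ℕ) ≠ l.1) with h | h
      · have := Nat.mul_le_mul_right (K + 3) h
        rw [Nat.succ_mul] at this
        omega
      · have := Nat.mul_le_mul_right (K + 3) h
        rw [Nat.succ_mul] at this
        omega
  have hi' := hi
  rw [hIco, Finset.mem_Ico] at hi'
  let L : Finset (Fin a) := s.toRight.image Prod.snd
  have hLmap : L.map ⟨fun l => (i, l), fun _ _ h => (Prod.ext_iff.1 h).2⟩ = s.toRight := by
    ext ⟨j, l⟩
    rw [Finset.mem_map]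
    constructor
    · rintro ⟨l', hl', h⟩
      obtain ⟨b, hb, rfl⟩ := Finset.mem_image.1 hl'
      rw [← h, ← hright _ hb]
      exact hb
    · exact fun hl => ⟨l, Finset.mem_image_of_mem _ hl, Prod.ext (hright _ hl).symm rfl⟩
  have hLcard : L.card = s.toRight.card := by
    rw [← hLmap, Finset.card_map]
  refine ⟨(i, ⟨L, ⟨i * (K + 3) + 2 - m, by omega⟩⟩), ?_⟩
  refine Eq.trans (congrArg₂ Finset.disjSum ?_ hLmap) Finset.toLeft_disjSum_toRight
  ext x
  rw [Finset.mem_toLeft, ← hmemA, hIco]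
  simp only [Finset.mem_filter, Finset.mem_univ, true_and, Finset.mem_Ico]
  omega

lemma subtreeCount_caterpillar_le (K N a : ℕ) :
    subtreeCount (caterpillar K N a) (K + 3) ≤
      N * ∑ j ∈ Finset.range (a + 1), a.choose j * (K + 3 - j) := by
  have h1 : subtreeCount (caterpillar K N a) (K + 3) ≤
      (Set.range (caterpillarSubtree (K := K) (N := N) (a := a))).ncard :=
    Set.ncard_le_ncard (fun s hs => exists_caterpillarSubtree_eq hs.1 hs.2) (Set.toFinite _)
  refine h1.trans ?_
  rw [← Set.image_univ]
  refine (Set.ncard_image_le (Set.toFinite _)).trans (le_of_eq ?_)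
  have h2 := Finset.sum_powerset_apply_card (fun j => K + 3 - j)
    (x := (Finset.univ : Finset (Fin a)))
  rw [Finset.powerset_univ] at h2
  rw [Set.ncard_univ, Nat.card_eq_fintype_card, Fintype.card_prod, Fintype.card_sigma,
    Fintype.card_fin]
  congr 1
  simpa using h2

lemma spineVertex_inj {K N q q' : ℕ} {i i' : Fin N} {hq : q < K + 3} {hq' : q' < K + 3} :
    spineVertex i q hq = spineVertex i' q' hq' ↔ i = i' ∧ q = q' := by
  refine ⟨fun h => ?_, ?_⟩
  · have h1 : (i : ℕ) * (K + 3) + q = i' * (K + 3) + q' := Fin.ext_iff.1 h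
    have hi : (i : ℕ) = i' := by
      have h2 := congrArg (· / (K + 3)) h1
      simpa [Nat.mul_add_div, mul_comm _ (K + 3), Nat.div_eq_of_lt, hq, hq'] using h2
    rw [hi] at h1
    exact ⟨Fin.ext hi, by omega⟩
  · rintro ⟨rfl, rfl⟩
    rfl

/-- The neighbours of the third spine vertex of block `i` other than the successor (or the
predecessor, if `b`) on the spine: a spine vertex for `none` and the leaves of the block. -/
def sparklerRay {K N a : ℕ} (hK : 2 ≤ K) (i : Fin N) (b : Bool) :
    Option (Fin a) ↪ CaterpillarVertex K N a where
  toFun o := o.elim (.inl (spineVertex i (if b then 3 else 1) (by split <;> omega)))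
    fun l => .inr (i, l)
  inj' := by
    rintro (_ | l) (_ | l') h <;> simp_all

@[simp]
lemma sparklerRay_none {K N a : ℕ} (hK : 2 ≤ K) (i : Fin N) (b : Bool) :
    sparklerRay (a := a) hK i b none =
      .inl (spineVertex i (if b then 3 else 1) (by split <;> omega)) :=
  rfl

@[simp]
lemma sparklerRay_some {K N a : ℕ} (hK : 2 ≤ K) (i : Fin N) (b : Bool) (l : Fin a) :
    sparklerRay hK i b (some l) = .inr (i, l) :=
  rfl

/-- The vertex set of a sparkler centered at the third spine vertex of a block, whose long ray
follows the spine downwards or upwards according to a Boolean. -/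
def caterpillarSparkler {K N a : ℕ} (hK : 2 ≤ K) (z : Fin N × Bool × Finset (Option (Fin a))) :
    Finset (CaterpillarVertex K N a) :=
  insert (.inl (spineVertex z.1 2 (by omega)))
    (insert (.inl (spineVertex z.1 (if z.2.1 then 1 else 3) (by split <;> omega)))
      (insert (.inl (spineVertex z.1 (if z.2.1 then 0 else 4) (by split <;> omega)))
        (z.2.2.map (sparklerRay hK z.1 z.2.1))))

lemma caterpillarSparkler_spec {K N a : ℕ} (hK : 2 ≤ K)
    {z : Fin N × Bool × Finset (Option (Fin a))} (hz : z.2.2.card = K) :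
    (caterpillarSparkler hK z).card = K + 3 ∧
      Nonempty ((caterpillar K N a).induce (caterpillarSparkler hK z : Set _) ≃g
        sparkler (K + 2)) := by
  obtain ⟨i, b, A⟩ := z
  refine sparkler_induce_iso (by simpa using hz) ?_ ?_ ?_ ?_ ?_ ?_ ?_ ?_ ?_
  · cases b <;> simp [caterpillar_adj_inl_inl, spineVertex]
  · cases b <;> simp [caterpillar_adj_inl_inl, spineVertex]
  · cases b <;> simp [caterpillar_adj_inl_inl, spineVertex] <;> omega
  · cases b <;> simp [spineVertex_inj]
  · rw [Finset.mem_map]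
    rintro ⟨_ | l, -, h⟩
    · cases b <;> simp [spineVertex_inj] at h
    · simp at h
  · simp only [Finset.forall_mem_map]
    rintro (_ | l) -
    · cases b <;> simp [caterpillar_adj_inl_inl, spineVertex]
    · simp [caterpillar_adj_inl_inr, spineVertex]
  · simp only [Finset.forall_mem_map]
    rintro (_ | l) -
    · cases b <;> simp [caterpillar_adj_inl_inl, spineVertex]
    · cases b <;> simp [caterpillar_adj_inl_inr, spineVertex]
  · simp only [Finset.forall_mem_map]
    rintro (_ | l) -
    · cases b <;> simp [caterpillar_adj_inl_inl, spineVertex] <;> omega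
    · cases b <;> simp [caterpillar_adj_inl_inr, spineVertex]
  · simp only [Finset.forall_mem_map]
    rintro (_ | l) - (_ | l') -
    · simp
    · cases b <;> simp [caterpillar_adj_inl_inr, spineVertex]
    · rw [SimpleGraph.adj_comm]
      cases b <;> simp [caterpillar_adj_inl_inr, spineVertex]
    · exact not_caterpillar_adj_inr_inr

lemma mem_caterpillarSparkler_inl {K N a : ℕ} (hK : 2 ≤ K)
    {z : Fin N × Bool × Finset (Option (Fin a))} {j : Fin N} {q : ℕ} {hq : q < K + 3}
    (h : Sum.inl (spineVertex j q hq) ∈ caterpillarSparkler hK z) :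
    j = z.1 ∧ q ≠ if z.2.1 then 4 else 0 := by
  simp only [caterpillarSparkler, Finset.mem_insert, Sum.inl.injEq, spineVertex_inj,
    Finset.mem_map] at h
  rcases h with h | h | h | ⟨_ | l, -, h⟩
  · refine ⟨h.1, ?_⟩
    split <;> omega
  · refine ⟨h.1, ?_⟩
    split_ifs at h ⊢ <;> omega
  · refine ⟨h.1, ?_⟩
    split_ifs at h ⊢ <;> omega
  · simp only [sparklerRay_none, Sum.inl.injEq, spineVertex_inj] at h
    refine ⟨h.1.symm, ?_⟩
    split_ifs at h ⊢ <;> omega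
  · simp at h

lemma sparklerRay_mem_iff {K N a : ℕ} (hK : 2 ≤ K) {i : Fin N} {b : Bool}
    {A : Finset (Option (Fin a))} {o : Option (Fin a)} :
    sparklerRay hK i b o ∈ caterpillarSparkler hK (i, b, A) ↔ o ∈ A := by
  simp only [caterpillarSparkler, Finset.mem_insert, Finset.mem_map']
  rcases o with _ | l <;> cases b <;> simp [spineVertex_inj]

lemma caterpillarSparkler_injective {K N a : ℕ} (hK : 2 ≤ K) :
    Function.Injective (caterpillarSparkler (K := K) (N := N) (a := a) hK) := by
  rintro ⟨i, b, A⟩ ⟨i', b', A'⟩ h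
  have hy : .inl (spineVertex i (if b then 0 else 4) (by split <;> omega)) ∈
      caterpillarSparkler hK (i', b', A') := by
    rw [← h]
    simp [caterpillarSparkler]
  obtain ⟨rfl, hb⟩ := mem_caterpillarSparkler_inl hK hy
  obtain rfl : b = b' := by
    cases b <;> cases b' <;> simp_all
  congr 2
  ext o
  rw [← sparklerRay_mem_iff hK, h, sparklerRay_mem_iff]

lemma le_embCount_caterpillar {K : ℕ} (hK : 2 ≤ K) (N a : ℕ) :
    N * (2 * (a + 1).choose K) ≤ embCount (caterpillar K N a) (sparkler (K + 2)) (K + 3) := by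
  let P : Finset (Fin N × Bool × Finset (Option (Fin a))) :=
    Finset.univ ×ˢ Finset.univ ×ˢ Finset.powersetCard K Finset.univ
  have hP : (P : Set (Fin N × Bool × Finset (Option (Fin a)))).ncard =
      N * (2 * (a + 1).choose K) := by
    simp [P, Set.ncard_coe_finset]
  rw [← hP]
  refine Set.ncard_le_ncard_of_injOn (caterpillarSparkler hK) (fun z hz => ?_)
    (caterpillarSparkler_injective hK).injOn (Set.toFinite _)
  refine caterpillarSparkler_spec hK ?_
  simpa [P] using hz

lemma two_mul_choose_le {a i : ℕ} (h : 3 * i + 2 ≤ a) : 2 * a.choose i ≤ a.choose (i + 1) := by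
  refine Nat.le_of_mul_le_mul_right (c := i + 1) ?_ i.succ_pos
  rw [Nat.choose_succ_right_eq, mul_comm 2, mul_assoc]
  exact Nat.mul_le_mul_left _ (by omega)

lemma sum_choose_le {a t : ℕ} (h : 3 * t ≤ a + 1) :
    ∑ j ∈ Finset.range (t + 1), a.choose j ≤ 2 * a.choose t := by
  induction t with
  | zero => simp
  | succ t ih =>
    rw [Finset.sum_range_succ]
    have h1 := ih (by omega)
    have h2 := two_mul_choose_le (a := a) (i := t) (by omega)
    omega

lemma sum_choose_mul_le {a t : ℕ} (h : 3 * t ≤ a + 1) :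
    ∑ j ∈ Finset.range (t + 1), a.choose j * (t + 1 - j) ≤ 4 * a.choose t := by
  induction t with
  | zero => simp
  | succ t ih =>
    have hsplit : ∑ j ∈ Finset.range (t + 1 + 1), a.choose j * (t + 1 + 1 - j) =
        ∑ j ∈ Finset.range (t + 1), a.choose j * (t + 1 - j) +
          ∑ j ∈ Finset.range (t + 1 + 1), a.choose j := by
      rw [Finset.sum_range_succ, Finset.sum_range_succ (fun j => a.choose j), ← add_assoc,
        ← Finset.sum_add_distrib]
      congr 1
      · refine Finset.sum_congr rfl fun j hj => ?_
        rw [Finset.mem_range] at hj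
        rw [show t + 1 + 1 - j = (t + 1 - j) + 1 by omega, mul_add_one]
      · simp
    rw [hsplit]
    have h1 := ih (by omega)
    have h2 := two_mul_choose_le (a := a) (i := t) (by omega)
    have h3 := sum_choose_le (a := a) (t := t + 1) (by omega)
    omega

lemma sum_choose_mul_le' (K : ℕ) :
    ∑ j ∈ Finset.range (3 * K + 5 + 1), (3 * K + 5).choose j * (K + 3 - j) ≤
      4 * (3 * K + 5).choose (K + 2) := by
  refine le_trans (le_of_eq ?_) (sum_choose_mul_le (a := 3 * K + 5) (t := K + 2) (by omega))
  symm
  refine Finset.sum_subset (Finset.range_subset_range.2 (by omega)) fun j _ hj => ?_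
  rw [Finset.mem_range] at hj
  rw [Nat.sub_eq_zero_of_le (by omega), mul_zero]

lemma choose_ratio {K : ℕ} (hK : 2 ≤ K) :
    13 * (4 * (3 * K + 5).choose (K + 2)) ≤ 165 * (2 * (3 * K + 5 + 1).choose K) := by
  have h1 := Nat.choose_succ_right_eq (3 * K + 6) K
  have h2 := Nat.choose_succ_right_eq (3 * K + 6) (K + 1)
  have h3 := Nat.choose_mul_succ_eq (3 * K + 5) (K + 2)
  rw [show 3 * K + 6 - K = 2 * K + 6 by omega] at h1
  rw [show 3 * K + 6 - (K + 1) = 2 * K + 5 by omega] at h2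
  rw [show 3 * K + 5 + 1 - (K + 2) = 2 * K + 4 by omega] at h3
  simp only [add_assoc, Nat.reduceAdd] at h1 h2 h3 ⊢
  generalize (3 * K + 6).choose K = x at *
  generalize (3 * K + 6).choose (K + 1) = y at *
  generalize (3 * K + 6).choose (K + 2) = z at *
  generalize (3 * K + 5).choose (K + 2) = w at *
  have h4 : 3 * w = 2 * z := by
    refine Nat.eq_of_mul_eq_mul_right (m := K + 2) (by omega) ?_
    linarith
  have h5 : 3 * w * ((K + 1) * (K + 2)) = 2 * x * ((2 * K + 6) * (2 * K + 5)) := by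
    calc 3 * w * ((K + 1) * (K + 2)) = 2 * (z * (K + 2)) * (K + 1) := by rw [h4]; ring
      _ = 2 * (y * (K + 1)) * (2 * K + 5) := by rw [h2]; ring
      _ = _ := by rw [h1]; ring
  have h6 : 104 * ((2 * K + 6) * (2 * K + 5)) ≤ 990 * ((K + 1) * (K + 2)) := by nlinarith
  refine Nat.le_of_mul_le_mul_right (c := 3 * ((K + 1) * (K + 2))) ?_ (by positivity)
  calc 13 * (4 * w) * (3 * ((K + 1) * (K + 2))) = 52 * (3 * w * ((K + 1) * (K + 2))) := by ring
    _ = x * (104 * ((2 * K + 6) * (2 * K + 5))) := by rw [h5]; ring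
    _ ≤ x * (990 * ((K + 1) * (K + 2))) := Nat.mul_le_mul_left _ h6
    _ = _ := by ring

lemma le_density_of_iso_caterpillar {K N m : ℕ} (hK : 2 ≤ K) (hN : 0 < N)
    {T : SimpleGraph (Fin m)} (φ : caterpillar K N (3 * K + 5) ≃g T) :
    (13 : ℝ) / 165 ≤ density (sparkler (K + 2)) T := by
  have hemb := (le_embCount_caterpillar hK N (3 * K + 5)).trans (embCount_le_of_iso φ _ _)
  have hsub := ((subtreeCount_le_of_iso φ.symm _).trans
    (subtreeCount_caterpillar_le K N (3 * K + 5))).trans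
      (Nat.mul_le_mul_left N (sum_choose_mul_le' K))
  have hpos : 0 < subtreeCount T (K + 3) := by
    refine lt_of_lt_of_le ?_ (hemb.trans (embCount_le_subtreeCount (sparkler_connected K) _))
    have := Nat.choose_pos (show K ≤ 3 * K + 5 + 1 by omega)
    positivity
  have hle : 13 * subtreeCount T (K + 3) ≤ 165 * embCount T (sparkler (K + 2)) (K + 3) := by
    have := Nat.mul_le_mul_left N (choose_ratio hK)
    linarith
  rw [density, Fintype.card_fin, div_le_div_iff₀ (by norm_num) (by exact_mod_cast hpos)]
  rw [mul_comm _ (165 : ℝ)]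
  exact_mod_cast hle

/-- For every k ≥ 4, the inducibility of the sparkler with k edges is at
least 13/165: there is a sequence of trees T n with |T n| → ∞ and
d(sparkler k, T n) ≥ 13/165 for all n. -/
theorem sparkler_inducibility_ge (k : ℕ) (hk : 4 ≤ k) :
    ∃ (m : ℕ → ℕ) (T : ∀ n, SimpleGraph (Fin (m n))),
      (∀ n, (T n).IsTree) ∧
      Filter.Tendsto m Filter.atTop Filter.atTop ∧
      ∀ n, (13 : ℝ) / 165 ≤ density (sparkler k) (T n) := by
  obtain ⟨K, rfl⟩ := Nat.exists_eq_add_of_le' (show 2 ≤ k by omega)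
  let V : ℕ → Type := fun n => CaterpillarVertex K (n + 1) (3 * K + 5)
  let φ := fun n => SimpleGraph.Iso.map (Fintype.equivFin (V n))
    (caterpillar K (n + 1) (3 * K + 5))
  refine ⟨fun n => Fintype.card (V n), fun n => _, fun n => ?_, ?_, fun n =>
    le_density_of_iso_caterpillar (by omega) n.succ_pos (φ n)⟩
  · exact (φ n).isTree_iff.1 (caterpillar_isTree n.succ_pos)
  · refine Filter.tendsto_atTop_mono (fun n => ?_) Filter.tendsto_id
    simp only [V, id, Fintype.card_sum, Fintype.card_fin]
    nlinarith
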